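/- arXiv:2509.00475 — 3 statements merged into one kernel-verified Lean document; each statement's English description precedes it below -/
import Mathlib

section
/- Assume the polynomial Lipschitz condition: there exist d₄ > 0, v > 0 and probability measures ν₃ ∈ 𝒫_{2r}, ν₄, ν₅ ∈ 𝒫_{vr} such that for all φ, ψ ∈ 𝒞_r and i ∈ S: |f(φ,i) − f(ψ,i)| ≤ d₄ (∫_{−∞}^0 |φ(u) − ψ(u)| ν₃(du)) (1 + ∫_{−∞}^0 (|φ(u)|^v + |ψ(u)|^v) ν₄(du)) and |g(φ,i) − g(ψ,i)|² ≤ d₄ (∫_{−∞}^0 |φ(u) − ψ(u)|² ν₃(du)) (1 + ∫_{−∞}^0 (|φ(u)|^v + |ψ(u)|^v) ν₅(du)). Set d₅ = 2(d₄ ∨ max_{i∈S}|f(0,i)| ∨ max_{i∈S}|g(0,i)|²), d₆ = ν₄^{(vr)} ∨ ν₅^{(vr)}, and Γ(R) = d₅(1 + d₆ R^v). Then for every R ≥ 0, every i ∈ S and every φ ∈ 𝒞_r with ‖φ‖_r ≤ R: |f(φ,i)|² ≤ Γ(R)² (1 + ∫_{−∞}^0 |φ(u)|² ν₃(du)) and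 |g(φ,i)|² ≤ Γ(R) (1 + ∫_{−∞}^0 |φ(u)|² ν₃(du)). -/
open MeasureTheory Filter Set

noncomputable section

/-- Euclidean norm on `Fin n → ℝ`. -/
def vnorm {n : ℕ} (x : Fin n → ℝ) : ℝ := Real.sqrt (∑ i, x i ^ 2)

/-- Frobenius norm of an `n × d` real matrix. -/
def frob {n d : ℕ} (A : Fin n → Fin d → ℝ) : ℝ := Real.sqrt (∑ i, ∑ j, A i j ^ 2)

/-- The weighted sup-norm `‖φ‖_r = sup_{u ≤ 0} e^{r u} |φ(u)|`. -/
def crNorm (r : ℝ) {n : ℕ} (φ : ℝ → Fin n → ℝ) : ℝ :=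
  sSup ((fun u => Real.exp (r * u) * vnorm (φ u)) '' Set.Iic 0)

/-- Membership in the phase space `𝒞_r`. -/
def MemCr (r : ℝ) {n : ℕ} (φ : ℝ → Fin n → ℝ) : Prop :=
  ContinuousOn φ (Set.Iic 0) ∧
    BddAbove ((fun u => Real.exp (r * u) * vnorm (φ u)) '' Set.Iic 0)

theorem vnorm_nonneg {n : ℕ} (x : Fin n → ℝ) : 0 ≤ vnorm x := Real.sqrt_nonneg _

theorem vnorm_sq {n : ℕ} (x : Fin n → ℝ) : vnorm x ^ 2 = ∑ i, x i ^ 2 :=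
  Real.sq_sqrt (Finset.sum_nonneg fun _ _ => sq_nonneg _)

theorem frob_sq {n d : ℕ} (A : Fin n → Fin d → ℝ) : frob A ^ 2 = ∑ i, ∑ j, A i j ^ 2 :=
  Real.sq_sqrt (Finset.sum_nonneg fun _ _ => Finset.sum_nonneg fun _ _ => sq_nonneg _)

@[simp] theorem vnorm_zero {n : ℕ} : vnorm (0 : Fin n → ℝ) = 0 := by simp [vnorm]

theorem continuous_vnorm {n : ℕ} : Continuous (vnorm : (Fin n → ℝ) → ℝ) := by
  unfold vnorm
  fun_prop

theorem vnorm_sq_le_add_sub {n : ℕ} (x y : Fin n → ℝ) :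
    vnorm x ^ 2 ≤ 2 * vnorm y ^ 2 + 2 * vnorm (x - y) ^ 2 := by
  simp only [vnorm_sq, Finset.mul_sum, ← Finset.sum_add_distrib, Pi.sub_apply]
  gcongr with i
  nlinarith [sq_nonneg (x i - 2 * y i)]

theorem frob_sq_le_add_sub {n d : ℕ} (A B : Fin n → Fin d → ℝ) :
    frob A ^ 2 ≤ 2 * frob B ^ 2 + 2 * frob (A - B) ^ 2 := by
  simp only [frob_sq, Finset.mul_sum, ← Finset.sum_add_distrib, Pi.sub_apply]
  gcongr with i _ j
  nlinarith [sq_nonneg (A i j - 2 * B i j)]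

theorem memCr_zero (r : ℝ) (n : ℕ) : MemCr r (0 : ℝ → Fin n → ℝ) :=
  ⟨continuousOn_const, 0, by rintro _ ⟨u, -, rfl⟩; simp⟩

theorem MemCr.vnorm_le {r R : ℝ} {n : ℕ} {φ : ℝ → Fin n → ℝ} (hφ : MemCr r φ)
    (hR : crNorm r φ ≤ R) {u : ℝ} (hu : u ≤ 0) : vnorm (φ u) ≤ R * Real.exp (-(r * u)) := by
  have h := (le_csSup hφ.2 ⟨u, hu, rfl⟩).trans hR
  rw [Real.exp_neg, ← div_eq_mul_inv, le_div_iff₀ (Real.exp_pos _), mul_comm]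
  exact h

theorem MemCr.vnorm_rpow_le {r R p : ℝ} {n : ℕ} {φ : ℝ → Fin n → ℝ} (hφ : MemCr r φ)
    (hR₀ : 0 ≤ R) (hR : crNorm r φ ≤ R) (hp : 0 ≤ p) {u : ℝ} (hu : u ≤ 0) :
    vnorm (φ u) ^ p ≤ R ^ p * Real.exp (-(p * r * u)) := by
  refine (Real.rpow_le_rpow (vnorm_nonneg _) (hφ.vnorm_le hR hu) hp).trans_eq ?_
  rw [Real.mul_rpow hR₀ (Real.exp_pos _).le, ← Real.exp_mul]
  ring_nf

theorem ae_nonpos_of_measure_Ioi_eq_zero {ν : Measure ℝ} (h : ν (Set.Ioi 0) = 0) :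
    ∀ᵐ u ∂ν, u ≤ 0 := by
  simpa [ae_iff, Set.Ioi] using h

theorem MemCr.integral_vnorm_rpow_le {r R p : ℝ} {n : ℕ} {φ : ℝ → Fin n → ℝ} (hφ : MemCr r φ)
    (hR₀ : 0 ≤ R) (hR : crNorm r φ ≤ R) (hp : 0 ≤ p) {ν : Measure ℝ} (hν : ν (Set.Ioi 0) = 0)
    (hint : Integrable (fun u => Real.exp (-(p * r * u))) ν) :
    ∫ u, vnorm (φ u) ^ p ∂ν ≤ (∫ u, Real.exp (-(p * r * u)) ∂ν) * R ^ p := by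
  rw [mul_comm, ← integral_const_mul]
  refine integral_mono_of_nonneg (ae_of_all _ fun u => Real.rpow_nonneg (vnorm_nonneg _) _)
    (hint.const_mul _) ?_
  filter_upwards [ae_nonpos_of_measure_Ioi_eq_zero hν] with u hu
  exact hφ.vnorm_rpow_le hR₀ hR hp hu

theorem MemCr.memLp_two_vnorm {r : ℝ} {n : ℕ} {φ : ℝ → Fin n → ℝ} (hφ : MemCr r φ)
    {ν : Measure ℝ} (hν : ν (Set.Ioi 0) = 0)
    (hint : Integrable (fun u => Real.exp (-(2 * r * u))) ν) :
    MemLp (fun u => vnorm (φ u)) 2 ν := by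
  have hae := ae_nonpos_of_measure_Ioi_eq_zero hν
  have hmeas : AEStronglyMeasurable (fun u => vnorm (φ u)) ν := by
    rw [← Measure.restrict_eq_self_of_ae_mem (s := Set.Iic 0) hae]
    exact (continuous_vnorm.comp_continuousOn hφ.1).aestronglyMeasurable measurableSet_Iic
  rw [memLp_two_iff_integrable_sq hmeas]
  refine (hint.const_mul (crNorm r φ ^ 2)).mono' (hmeas.pow 2) ?_
  filter_upwards [hae] with u hu
  rw [Real.norm_of_nonneg (sq_nonneg _)]
  refine (pow_le_pow_left₀ (vnorm_nonneg _) (hφ.vnorm_le le_rfl hu) 2).trans_eq ?_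
  rw [mul_pow, ← Real.exp_nat_mul]
  push_cast
  ring_nf

theorem sq_integral_le_integral_sq {Ω : Type*} [MeasurableSpace Ω] {μ : Measure Ω}
    [IsProbabilityMeasure μ] {X : Ω → ℝ} (hX : MemLp X 2 μ) :
    (∫ ω, X ω ∂μ) ^ 2 ≤ ∫ ω, X ω ^ 2 ∂μ := by
  have h := ProbabilityTheory.variance_nonneg X μ
  rw [ProbabilityTheory.variance_eq_sub hX] at h
  simpa using h

/-- Under the polynomial Lipschitz condition (Assumption 4.3), the explicit growth
function `Γ(R) = d₅ (1 + d₆ R^v)` of Remark 4.4 dominates `f` and `g`. -/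
theorem explicit_growth_function
    (r : ℝ) (hr : 0 < r) (n d : ℕ)
    (S : Type) [Fintype S] [Nonempty S]
    (f : (ℝ → Fin n → ℝ) → S → Fin n → ℝ)
    (g : (ℝ → Fin n → ℝ) → S → Fin n → Fin d → ℝ)
    (d₄ v : ℝ) (hd₄ : 0 < d₄) (hv : 0 < v)
    (ν₃ ν₄ ν₅ : Measure ℝ)
    [IsProbabilityMeasure ν₃] [IsProbabilityMeasure ν₄] [IsProbabilityMeasure ν₅]
    (hν₃supp : ν₃ (Set.Ioi 0) = 0) (hν₄supp : ν₄ (Set.Ioi 0) = 0)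
    (hν₅supp : ν₅ (Set.Ioi 0) = 0)
    (hν₃ : Integrable (fun u => Real.exp (-(2 * r * u))) ν₃)
    (hν₄ : Integrable (fun u => Real.exp (-(v * r * u))) ν₄)
    (hν₅ : Integrable (fun u => Real.exp (-(v * r * u))) ν₅)
    (hfLip : ∀ (φ ψ : ℝ → Fin n → ℝ) (i : S), MemCr r φ → MemCr r ψ →
      vnorm (f φ i - f ψ i)
        ≤ d₄ * (∫ u, vnorm (φ u - ψ u) ∂ν₃)
          * (1 + ∫ u, ((vnorm (φ u)) ^ v + (vnorm (ψ u)) ^ v) ∂ν₄))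
    (hgLip : ∀ (φ ψ : ℝ → Fin n → ℝ) (i : S), MemCr r φ → MemCr r ψ →
      (frob (g φ i - g ψ i)) ^ 2
        ≤ d₄ * (∫ u, (vnorm (φ u - ψ u)) ^ 2 ∂ν₃)
          * (1 + ∫ u, ((vnorm (φ u)) ^ v + (vnorm (ψ u)) ^ v) ∂ν₅))
    (d₅ d₆ : ℝ)
    (hd₅ : d₅ = 2 * max d₄ (max (⨆ i : S, vnorm (f 0 i)) (⨆ i : S, (frob (g 0 i)) ^ 2)))
    (hd₆ : d₆ = max (∫ u, Real.exp (-(v * r * u)) ∂ν₄) (∫ u, Real.exp (-(v * r * u)) ∂ν₅)) :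
    ∀ (R : ℝ), 0 ≤ R → ∀ (i : S) (φ : ℝ → Fin n → ℝ), MemCr r φ → crNorm r φ ≤ R →
      (vnorm (f φ i)) ^ 2
        ≤ (d₅ * (1 + d₆ * R ^ v)) ^ 2 * (1 + ∫ u, (vnorm (φ u)) ^ 2 ∂ν₃) ∧
      (frob (g φ i)) ^ 2
        ≤ (d₅ * (1 + d₆ * R ^ v)) * (1 + ∫ u, (vnorm (φ u)) ^ 2 ∂ν₃) := by
  intro R hR₀ i φ hφ hR
  set M := max d₄ (max (⨆ i : S, vnorm (f 0 i)) (⨆ i : S, (frob (g 0 i)) ^ 2))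
  have hd₄M : d₄ ≤ M := le_max_left _ _
  have hM₀ : 0 ≤ M := hd₄.le.trans hd₄M
  have hf₀ : vnorm (f 0 i) ≤ M :=
    (le_ciSup (f := fun i => vnorm (f 0 i)) (Set.finite_range _).bddAbove i).trans
      ((le_max_left _ _).trans (le_max_right _ _))
  have hg₀ : frob (g 0 i) ^ 2 ≤ M :=
    (le_ciSup (f := fun i => frob (g 0 i) ^ 2) (Set.finite_range _).bddAbove i).trans
      ((le_max_right _ _).trans (le_max_right _ _))
  have hf := hfLip φ 0 i hφ (memCr_zero r n)
  have hg := hgLip φ 0 i hφ (memCr_zero r n)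
  simp only [Pi.zero_apply, sub_zero, vnorm_zero, Real.zero_rpow hv.ne', add_zero] at hf hg
  have hRv : 0 ≤ R ^ v := Real.rpow_nonneg hR₀ v
  have hK₄ : ∫ u, vnorm (φ u) ^ v ∂ν₄ ≤ d₆ * R ^ v :=
    (hφ.integral_vnorm_rpow_le hR₀ hR hv.le hν₄supp hν₄).trans
      (mul_le_mul_of_nonneg_right (hd₆ ▸ le_max_left _ _) hRv)
  have hK₅ : ∫ u, vnorm (φ u) ^ v ∂ν₅ ≤ d₆ * R ^ v :=
    (hφ.integral_vnorm_rpow_le hR₀ hR hv.le hν₅supp hν₅).trans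
      (mul_le_mul_of_nonneg_right (hd₆ ▸ le_max_right _ _) hRv)
  have hI (ν : Measure ℝ) : 0 ≤ ∫ u, vnorm (φ u) ^ v ∂ν :=
    integral_nonneg fun u => Real.rpow_nonneg (vnorm_nonneg (φ u)) v
  have hK₀ : 0 ≤ d₆ * R ^ v := (hI ν₄).trans hK₄
  have hsq := sq_integral_le_integral_sq (hφ.memLp_two_vnorm hν₃supp hν₃)
  have ha₀ : 0 ≤ ∫ u, vnorm (φ u) ∂ν₃ := integral_nonneg fun u => vnorm_nonneg _
  have hb₀ : 0 ≤ ∫ u, vnorm (φ u) ^ 2 ∂ν₃ := integral_nonneg fun u => sq_nonneg _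
  rw [hd₅]
  generalize d₆ * R ^ v = K at *
  generalize (∫ u, vnorm (φ u) ∂ν₃) = a at *
  generalize (∫ u, vnorm (φ u) ^ 2 ∂ν₃) = b at *
  constructor
  · have hf' : vnorm (f φ i - f 0 i) ≤ M * a * (1 + K) := hf.trans (by have := hI ν₄; gcongr)
    calc vnorm (f φ i) ^ 2
        ≤ 2 * vnorm (f 0 i) ^ 2 + 2 * vnorm (f φ i - f 0 i) ^ 2 := vnorm_sq_le_add_sub _ _
      _ ≤ 2 * (M * (1 + K)) ^ 2 + 2 * (M * a * (1 + K)) ^ 2 := by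
          gcongr
          · exact vnorm_nonneg _
          · exact hf₀.trans (le_mul_of_one_le_right hM₀ (by linarith))
          · exact vnorm_nonneg _
      _ = 2 * (M * (1 + K)) ^ 2 * (1 + a ^ 2) := by ring
      _ ≤ 4 * (M * (1 + K)) ^ 2 * (1 + b) := by gcongr; norm_num
      _ = (2 * M * (1 + K)) ^ 2 * (1 + b) := by ring
  · have hg' : frob (g φ i - g 0 i) ^ 2 ≤ M * b * (1 + K) := hg.trans (by have := hI ν₅; gcongr)
    calc frob (g φ i) ^ 2
        ≤ 2 * frob (g 0 i) ^ 2 + 2 * frob (g φ i - g 0 i) ^ 2 := frob_sq_le_add_sub _ _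
      _ ≤ 2 * (M * (1 + K)) + 2 * (M * b * (1 + K)) := by
          gcongr
          exact hg₀.trans (le_mul_of_one_le_right hM₀ (by linarith))
      _ = 2 * M * (1 + K) * (1 + b) := by ring
end
end

section
/- Let c ≥ 0, κ > 0, k ≥ 0, B̄ ≥ 0 and t ≥ 0, let ρ be a Borel probability measure on (−∞,0] with ρ^{(c+κ)} := ∫_{−∞}^0 e^{−(c+κ)u} ρ(du) < ∞, and let b : ℝ → [0, B̄] be Borel measurable. Then ∫_0^t ( ρ((−∞,−k]) b(s+k) e^{ck} + ∫_{(−k,0]} b(s−u) e^{−cu} ρ(du) ) ds ≤ B̄ ρ^{(c+κ)} / (eκ) + ρ^{(c)} ∫_0^t b(s) ds, where ρ^{(c)} := ∫_{−∞}^0 e^{−cu} ρ(du). -/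
open MeasureTheory Filter Set

noncomputable section

/-- Translating the window `[0, t]` by `v ≥ 0` increases the integral of a function with values in
`[0, M]` by at most `M * v`. -/
lemma intervalIntegral_comp_add_right_le {b : ℝ → ℝ} {M t v : ℝ} (hbmeas : Measurable b)
    (hb : ∀ s, b s ∈ Set.Icc 0 M) (hv : 0 ≤ v) :
    ∫ s in (0:ℝ)..t, b (s + v) ≤ (∫ s in (0:ℝ)..t, b s) + M * v := by
  have hbint : ∀ x y : ℝ, IntervalIntegrable b volume x y := fun x y =>
    (intervalIntegrable_const (c := M)).mono_fun hbmeas.aestronglyMeasurable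
      (Eventually.of_forall fun s => by
        beta_reduce
        rw [Real.norm_of_nonneg (hb s).1]
        exact (hb s).2.trans (le_abs_self M))
  rw [intervalIntegral.integral_comp_add_right, zero_add]
  have hsplit := intervalIntegral.integral_add_adjacent_intervals (hbint 0 v) (hbint v (t + v))
  have hsplit' := intervalIntegral.integral_add_adjacent_intervals (hbint 0 t) (hbint t (t + v))
  have hnonneg : 0 ≤ ∫ s in (0:ℝ)..v, b s :=
    intervalIntegral.integral_nonneg hv fun s _ => (hb s).1
  have hle : ∫ s in t..(t + v), b s ≤ ∫ _ in t..(t + v), M :=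
    intervalIntegral.integral_mono_on (by linarith) (hbint _ _) intervalIntegrable_const
      fun s _ => (hb s).2
  rw [intervalIntegral.integral_const, smul_eq_mul, add_sub_cancel_left] at hle
  linarith

lemma mul_exp_le_exp_add_div {c κ v : ℝ} (hκ : 0 < κ) :
    Real.exp (c * v) * v ≤ Real.exp ((c + κ) * v) / (Real.exp 1 * κ) := by
  rw [le_div_iff₀ (by positivity), add_mul, Real.exp_add, mul_assoc]
  refine mul_le_mul_of_nonneg_left ?_ (Real.exp_pos _).le
  have h := Real.add_one_le_exp (κ * v - 1)
  rw [sub_add_cancel, Real.exp_sub, le_div_iff₀ (Real.exp_pos _)] at h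
  linarith

/-- The integral of a function of the truncated delay `min (-u) k` splits at `-k`. -/
lemma integral_comp_truncation {ρ : Measure ℝ} [IsFiniteMeasure ρ] (hsupp : ρ (Set.Ioi 0) = 0)
    {k : ℝ} (hk : 0 ≤ k) {f : ℝ → ℝ}
    (hf : Integrable (fun u => f (max 0 (min (-u) k))) ρ) :
    ∫ u, f (max 0 (min (-u) k)) ∂ρ
      = (ρ (Set.Iic (-k))).toReal * f k + ∫ u in Set.Ioc (-k) 0, f (-u) ∂ρ := by
  have hae : ∀ᵐ u ∂ρ, u ∈ Set.Iic (0:ℝ) := by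
    rw [ae_iff]
    simpa [Set.Ioi_def] using hsupp
  rw [← Measure.restrict_eq_self_of_ae_mem hae] at hf
  rw [← setIntegral_eq_integral_of_ae_compl_eq_zero (s := Set.Iic (0:ℝ))
      (hae.mono fun u hu hn => absurd hu hn),
    ← Set.Iic_union_Ioc_eq_Iic (neg_nonpos.mpr hk),
    setIntegral_union (Set.Iic_disjoint_Ioc le_rfl) measurableSet_Ioc
      (hf.mono_measure (Measure.restrict_mono (Set.Iic_subset_Iic.mpr (by linarith)) le_rfl))
      (hf.mono_measure (Measure.restrict_mono Set.Ioc_subset_Iic_self le_rfl))]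
  congr 1
  · rw [setIntegral_congr_fun (g := fun _ => f k) measurableSet_Iic, setIntegral_const,
      smul_eq_mul, Measure.real]
    intro u hu
    have hu' : k ≤ -u := by linarith [Set.mem_Iic.mp hu]
    simp [min_eq_right hu', max_eq_right hk]
  · refine setIntegral_congr_fun measurableSet_Ioc fun u hu => ?_
    have h₁ : -u ≤ k := by linarith [hu.1]
    have h₂ : 0 ≤ -u := by linarith [hu.2]
    simp only [min_eq_left h₁, max_eq_right h₂]

/-- Display (5.7)-(5.9) of the paper: for `c ≥ 0`, `κ > 0`, `k ≥ 0`, a bounded Borel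
function `0 ≤ b ≤ B̄` and a probability measure `ρ` on `(-∞,0]` with
`ρ^{(c+κ)} < ∞`,
`∫_0^t ( ρ((-∞,-k]) b(s+k) e^{ck} + ∫_{(-k,0]} b(s-u) e^{-cu} ρ(du) ) ds
  ≤ B̄ ρ^{(c+κ)}/(eκ) + ρ^{(c)} ∫_0^t b(s) ds`. -/
theorem shifted_rate_estimate
    (c κ k Bbar t : ℝ) (hc : 0 ≤ c) (hκ : 0 < κ) (hk : 0 ≤ k)
    (hBbar : 0 ≤ Bbar) (ht : 0 ≤ t)
    (ρ : Measure ℝ) [IsProbabilityMeasure ρ] (hsupp : ρ (Set.Ioi 0) = 0)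
    (hmom : Integrable (fun u => Real.exp (-((c + κ) * u))) ρ)
    (b : ℝ → ℝ) (hbmeas : Measurable b) (hb : ∀ s : ℝ, b s ∈ Set.Icc 0 Bbar) :
    ∫ s in (0:ℝ)..t,
        ((ρ (Set.Iic (-k))).toReal * b (s + k) * Real.exp (c * k)
          + ∫ u in Set.Ioc (-k) 0, b (s - u) * Real.exp (-(c * u)) ∂ρ)
      ≤ Bbar * (∫ u, Real.exp (-((c + κ) * u)) ∂ρ) / (Real.exp 1 * κ)
        + (∫ u, Real.exp (-(c * u)) ∂ρ) * ∫ s in (0:ℝ)..t, b s := by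
  have hae : ∀ᵐ u ∂ρ, u ≤ 0 := by
    rw [ae_iff]
    simpa [Set.Ioi_def] using hsupp
  set v : ℝ → ℝ := fun u => max 0 (min (-u) k) with hvdef
  have hvm : Measurable v := by fun_prop
  have hv0 : ∀ u, 0 ≤ v u := fun u => le_max_left _ _
  have hvk : ∀ u, v u ≤ k := fun u => max_le hk (min_le_right _ _)
  have hvu : ∀ u ≤ 0, v u ≤ -u := fun u hu => max_le (by linarith) (min_le_left _ _)
  have hbound : ∀ s u, ‖b (s + v u) * Real.exp (c * v u)‖ ≤ Bbar * Real.exp (c * k) := by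
    intro s u
    rw [Real.norm_of_nonneg (mul_nonneg (hb _).1 (Real.exp_pos _).le)]
    have h₁ := (hb (s + v u)).2
    have h₂ := hvk u
    gcongr
  have hswap : Integrable (Function.uncurry fun s u => b (s + v u) * Real.exp (c * v u))
      ((volume.restrict (Set.Ioc 0 t)).prod ρ) := by
    refine Integrable.of_bound (Measurable.aestronglyMeasurable ?_) (Bbar * Real.exp (c * k))
      (Eventually.of_forall fun p => hbound p.1 p.2)
    unfold Function.uncurry
    fun_prop
  have hsplit : ∀ s, (ρ (Set.Iic (-k))).toReal * b (s + k) * Real.exp (c * k)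
      + ∫ u in Set.Ioc (-k) 0, b (s - u) * Real.exp (-(c * u)) ∂ρ
      = ∫ u, b (s + v u) * Real.exp (c * v u) ∂ρ := by
    intro s
    have hbint : Integrable (fun u => b (s + v u) * Real.exp (c * v u)) ρ :=
      Integrable.of_bound (Measurable.aestronglyMeasurable (by fun_prop)) _
        (Eventually.of_forall (hbound s))
    rw [integral_comp_truncation (f := fun w => b (s + w) * Real.exp (c * w)) hsupp hk hbint]
    simp only [mul_assoc, mul_neg, sub_eq_add_neg]
  have hmom' : Integrable (fun u => Real.exp (-(c * u))) ρ := by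
    refine hmom.mono' (by fun_prop) (hae.mono fun u hu => ?_)
    rw [Real.norm_of_nonneg (Real.exp_pos _).le]
    exact Real.exp_le_exp.mpr (by nlinarith)
  have hI : 0 ≤ ∫ s in (0:ℝ)..t, b s := intervalIntegral.integral_nonneg ht fun s _ => (hb s).1
  simp only [hsplit]
  rw [intervalIntegral.integral_of_le ht, integral_integral_swap hswap, ← integral_const_mul,
    ← integral_div, ← integral_mul_const,
    ← integral_add ((hmom.const_mul _).div_const _) (hmom'.mul_const _)]
  refine integral_mono_ae hswap.integral_prod_right
    (((hmom.const_mul _).div_const _).add (hmom'.mul_const _)) (hae.mono fun u hu => ?_)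
  have hexp : ∀ {a : ℝ}, 0 ≤ a → Real.exp (a * v u) ≤ Real.exp (-(a * u)) := fun ha =>
    Real.exp_le_exp.mpr (by nlinarith [hvu u hu])
  calc ∫ s in Set.Ioc 0 t, b (s + v u) * Real.exp (c * v u)
      = (∫ s in (0:ℝ)..t, b (s + v u)) * Real.exp (c * v u) := by
        rw [integral_mul_const, intervalIntegral.integral_of_le ht]
    _ ≤ ((∫ s in (0:ℝ)..t, b s) + Bbar * v u) * Real.exp (c * v u) := by
        gcongr
        exact intervalIntegral_comp_add_right_le hbmeas hb (hv0 u)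
    _ = Bbar * (Real.exp (c * v u) * v u) + Real.exp (c * v u) * ∫ s in (0:ℝ)..t, b s := by ring
    _ ≤ Bbar * (Real.exp (-((c + κ) * u)) / (Real.exp 1 * κ))
        + Real.exp (-(c * u)) * ∫ s in (0:ℝ)..t, b s := by
        gcongr ?_ * ?_ + ?_ * _
        · refine (mul_exp_le_exp_add_div hκ).trans ?_
          gcongr ?_ / _
          exact hexp (by linarith)
        · exact hexp hc
    _ = Bbar * Real.exp (-((c + κ) * u)) / (Real.exp 1 * κ)
        + Real.exp (-(c * u)) * ∫ s in (0:ℝ)..t, b s := by rw [mul_div_assoc]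
end
end

section
/- Let r > 0, c > 0 and κ > 0, and let ρ be a Borel probability measure on (−∞,0] with ρ^{((c+κ)∨(2r))} := ∫_{−∞}^0 e^{−((c+κ)∨(2r))u} ρ(du) < ∞. For each integer k ≥ 1 set I_k := ρ((−∞,−k]) e^{ck} ∫_{−k}^0 e^{−(2r−c)s} ds + ∫_{(−k,0]} e^{−cu} ( ∫_u^0 e^{−(2r−c)s} ds ) ρ(du). Then sup_{k ≥ 1} I_k < ∞; more precisely, I_k ≤ ρ^{(c+κ)} / (eκ) for all k if 2r = c, and I_k ≤ ρ^{((2r)∨c)} / |2r − c| for all k if 2r ≠ c. -/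
open MeasureTheory Filter Set

noncomputable section

/-- On `u ≤ 0`, the function `u ↦ e^{-au}` is integrable as soon as some `e^{-bu}` with `a ≤ b` is. -/
theorem integrable_exp_neg_mul_of_le {ρ : Measure ℝ} (hsupp : ρ (Ioi 0) = 0) {a b : ℝ}
    (hab : a ≤ b) (hb : Integrable (fun u => Real.exp (-b * u)) ρ) :
    Integrable (fun u => Real.exp (-(a * u))) ρ := by
  refine hb.mono' (by fun_prop) ?_
  have hae : ∀ᵐ u ∂ρ, u ∉ Ioi (0 : ℝ) := measure_eq_zero_iff_ae_notMem.1 hsupp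
  filter_upwards [hae] with u hu
  have hu' : u ≤ 0 := not_lt.1 hu
  rw [Real.norm_eq_abs, Real.abs_exp]
  exact Real.exp_le_exp.2 (by nlinarith)

/-- If `0 ≤ h ≤ F` on `(-∞,0]` with `F` antitone, nonnegative and integrable, then integrating `h`
stopped at level `x ≤ 0` gives at most the integral of `F`. -/
theorem measureReal_Iic_mul_add_setIntegral_le {ρ : Measure ℝ} [IsFiniteMeasure ρ]
    {h F : ℝ → ℝ} (hF : Antitone F) (hF0 : ∀ u, 0 ≤ F u) (hFi : Integrable F ρ)
    (h0 : ∀ u ≤ 0, 0 ≤ h u) (hle : ∀ u ≤ 0, h u ≤ F u) {x : ℝ} (hx : x ≤ 0) :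
    (ρ (Iic x)).toReal * h x + ∫ u in Ioc x 0, h u ∂ρ ≤ ∫ u, F u ∂ρ := by
  have h1 : (ρ (Iic x)).toReal * h x ≤ ∫ u in Iic x, F u ∂ρ := by
    calc (ρ (Iic x)).toReal * h x = ∫ _ in Iic x, h x ∂ρ := by
          simp [Measure.real]
      _ ≤ ∫ u in Iic x, F u ∂ρ :=
          setIntegral_mono_on integrableOn_const hFi.integrableOn measurableSet_Iic
            fun u hu => (hle x hx).trans (hF hu)
  have h2 : ∫ u in Ioc x 0, h u ∂ρ ≤ ∫ u in Ioc x 0, F u ∂ρ := by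
    refine integral_mono_of_nonneg ?_ hFi.integrableOn ?_
    · filter_upwards [ae_restrict_mem measurableSet_Ioc] with u hu using h0 u hu.2
    · filter_upwards [ae_restrict_mem measurableSet_Ioc] with u hu using hle u hu.2
  calc _ ≤ (∫ u in Iic x, F u ∂ρ) + ∫ u in Ioc x 0, F u ∂ρ := add_le_add h1 h2
    _ = ∫ u in Iic x ∪ Ioc x 0, F u ∂ρ :=
        (setIntegral_union (Set.disjoint_left.2 fun u hu hu' => not_lt.2 hu hu'.1)
          measurableSet_Ioc hFi.integrableOn hFi.integrableOn).symm
    _ ≤ ∫ u, F u ∂ρ := setIntegral_le_integral hFi (Eventually.of_forall hF0)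

theorem integral_exp_neg_mul_zero {d : ℝ} (hd : d ≠ 0) (u : ℝ) :
    ∫ s in u..(0 : ℝ), Real.exp (-(d * s)) = (Real.exp (-(d * u)) - 1) / d := by
  have hderiv : ∀ s ∈ uIcc u 0,
      HasDerivAt (fun s => -Real.exp (-(d * s)) / d) (Real.exp (-(d * s))) s := by
    intro s _
    have := ((((hasDerivAt_id s).const_mul d).neg.exp).neg).div_const d
    refine this.congr_deriv ?_
    simp only [id]
    field_simp
    simp
  rw [intervalIntegral.integral_eq_sub_of_hasDerivAt hderiv
    (Continuous.intervalIntegrable (by fun_prop) _ _)]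
  simp
  ring

/-- Kernel bound in the critical case. -/
theorem exp_neg_mul_mul_neg_le {c κ : ℝ} (hκ : 0 < κ) (u : ℝ) :
    Real.exp (-(c * u)) * -u ≤ Real.exp (-((c + κ) * u)) / (Real.exp 1 * κ) := by
  have h := Real.add_one_le_exp (-(κ * u) - 1)
  rw [Real.exp_sub] at h
  have h' : -u ≤ Real.exp (-(κ * u)) / (Real.exp 1 * κ) := by
    rw [← div_div, le_div_iff₀ hκ]
    linarith
  have e : Real.exp (-((c + κ) * u)) = Real.exp (-(c * u)) * Real.exp (-(κ * u)) := by
    rw [← Real.exp_add]; ring_nf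
  rw [e, mul_div_assoc]
  exact mul_le_mul_of_nonneg_left h' (Real.exp_pos _).le

/-- Kernel bound in the noncritical case. -/
theorem exp_neg_mul_mul_integral_le {b c : ℝ} (hbc : b ≠ c) (u : ℝ) :
    Real.exp (-(c * u)) * ((Real.exp (-((b - c) * u)) - 1) / (b - c)) ≤
      Real.exp (-(max b c * u)) / |b - c| := by
  have e : Real.exp (-(c * u)) * Real.exp (-((b - c) * u)) = Real.exp (-(b * u)) := by
    rw [← Real.exp_add]; ring_nf
  rw [← mul_div_assoc, mul_sub, e, mul_one]
  rcases lt_or_gt_of_ne hbc with h | h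
  · rw [max_eq_right h.le, abs_of_neg (sub_neg.2 h), ← neg_div_neg_eq]
    have := sub_pos.2 h
    gcongr
    · linarith
    · linarith [Real.exp_pos (-(b * u))]
  · rw [max_eq_left h.le, abs_of_pos (sub_pos.2 h)]
    have := sub_pos.2 h
    gcongr
    linarith [Real.exp_pos (-(c * u))]

/-- Display (5.13) of the paper: uniform boundedness (in `k ≥ 1`) of
`I_k = ρ((-∞,-k]) e^{ck} ∫_{-k}^0 e^{-(2r-c)s} ds
      + ∫_{(-k,0]} e^{-cu} (∫_u^0 e^{-(2r-c)s} ds) ρ(du)`,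
with the explicit bounds `I_k ≤ ρ^{(c+κ)}/(eκ)` when `2r = c` and
`I_k ≤ ρ^{((2r)∨c)}/|2r-c|` when `2r ≠ c`. -/
theorem uniform_Ik_bound
    (r c κ : ℝ) (hr : 0 < r) (hc : 0 < c) (hκ : 0 < κ)
    (ρ : Measure ℝ) [IsProbabilityMeasure ρ] (hsupp : ρ (Set.Ioi 0) = 0)
    (hmom : Integrable (fun u => Real.exp (-(max (c + κ) (2 * r)) * u)) ρ)
    (I : ℕ → ℝ)
    (hI : ∀ k : ℕ, I k
      = (ρ (Set.Iic (-(k : ℝ)))).toReal * Real.exp (c * k)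
          * (∫ s in (-(k : ℝ))..0, Real.exp (-((2 * r - c) * s)))
        + ∫ u in Set.Ioc (-(k : ℝ)) 0,
            Real.exp (-(c * u)) * (∫ s in u..(0:ℝ), Real.exp (-((2 * r - c) * s))) ∂ρ) :
    BddAbove (Set.range fun k : ℕ => I (k + 1)) ∧
    (2 * r = c → ∀ k : ℕ, 1 ≤ k →
      I k ≤ (∫ u, Real.exp (-((c + κ) * u)) ∂ρ) / (Real.exp 1 * κ)) ∧
    (2 * r ≠ c → ∀ k : ℕ, 1 ≤ k →
      I k ≤ (∫ u, Real.exp (-(max (2 * r) c * u)) ∂ρ) / |2 * r - c|) := by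
  have key : ∀ a C : ℝ, 0 ≤ a → 0 ≤ C → a ≤ max (c + κ) (2 * r) →
      (∀ u : ℝ, u ≤ 0 → Real.exp (-(c * u)) * (∫ s in u..(0:ℝ), Real.exp (-((2 * r - c) * s)))
        ≤ Real.exp (-(a * u)) / C) →
      ∀ k : ℕ, I k ≤ (∫ u, Real.exp (-(a * u)) ∂ρ) / C := by
    intro a C ha hC ham hle k
    have hk : -(k : ℝ) ≤ 0 := neg_nonpos.2 k.cast_nonneg
    have hmono : Antitone fun u : ℝ => Real.exp (-(a * u)) / C := by
      intro u v huv
      dsimp only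
      gcongr
    have h := measureReal_Iic_mul_add_setIntegral_le (ρ := ρ) hmono (fun u => by positivity)
      ((integrable_exp_neg_mul_of_le hsupp ham hmom).div_const C)
      (fun u hu => mul_nonneg (Real.exp_pos _).le
        (intervalIntegral.integral_nonneg hu fun s _ => (Real.exp_pos _).le)) hle hk
    rw [integral_div] at h
    rw [hI, mul_assoc]
    simpa only [mul_neg, neg_neg] using h
  have hcrit : 2 * r = c → ∀ k : ℕ,
      I k ≤ (∫ u, Real.exp (-((c + κ) * u)) ∂ρ) / (Real.exp 1 * κ) := by
    intro h
    refine key _ _ (by positivity) (by positivity) (le_max_left _ _) fun u _ => ?_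
    simpa [h] using exp_neg_mul_mul_neg_le (c := c) hκ u
  have hnoncrit : 2 * r ≠ c → ∀ k : ℕ,
      I k ≤ (∫ u, Real.exp (-(max (2 * r) c * u)) ∂ρ) / |2 * r - c| := by
    intro h
    refine key _ _ (le_max_of_le_right hc.le) (abs_nonneg _)
      (max_le (le_max_right _ _) (le_max_of_le_left (by linarith))) fun u _ => ?_
    rw [integral_exp_neg_mul_zero (sub_ne_zero.2 h)]
    exact exp_neg_mul_mul_integral_le h u
  refine ⟨?_, fun h k _ => hcrit h k, fun h k _ => hnoncrit h k⟩
  by_cases h : 2 * r = c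
  · exact ⟨_, forall_mem_range.2 fun k => hcrit h (k + 1)⟩
  · exact ⟨_, forall_mem_range.2 fun k => hnoncrit h (k + 1)⟩
end
end
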